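/- Convergence of the first discrete eigenvalue: let λ₁ be the smallest eigenvalue of the clamped biharmonic operator on [0,1], and for each integer N ≥ 2 let μ_{h,1} denote the largest eigenvalue of the matrix K^h (h = 1/N). Then μ_{h,1} → λ₁⁻¹ as N → ∞; equivalently, the smallest eigenvalue λ_{h,1} = 1/μ_{h,1} of the discrete biharmonic operator converges to λ₁ as h → 0. -/

import Mathlib

open Set Filter

/-- `lam` is an eigenvalue of the clamped biharmonic operator on `[0,1]`. -/
def IsClampedBiharmonicEV (lam : ℝ) : Prop :=
  ∃ φ : ℝ → ℝ, ContDiff ℝ 4 φ ∧ (∃ x ∈ Set.Icc (0:ℝ) 1, φ x ≠ 0) ∧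
    (∀ x ∈ Set.Icc (0:ℝ) 1, iteratedDeriv 4 φ x = lam * φ x) ∧
    φ 0 = 0 ∧ deriv φ 0 = 0 ∧ φ 1 = 0 ∧ deriv φ 1 = 0

/-- Green's kernel of the clamped biharmonic operator on `[0,1]`. -/
noncomputable def Kgreen (x y : ℝ) : ℝ :=
  if y ≤ x then (1/6) * (1 - x)^2 * y^2 * (2*x*(1 - y) + x - y)
  else (1/6) * x^2 * (1 - y)^2 * (2*y*(1 - x) + y - x)

/-- The `(N-1)×(N-1)` matrix `K^h` with entries `K^h_{i,j} = h·K(x_i, x_j)`, `h = 1/N`. -/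
noncomputable def Kmat (N : ℕ) : Matrix (Fin (N-1)) (Fin (N-1)) ℝ :=
  fun i j => ((1:ℝ)/N) * Kgreen (((i : ℕ) + 1 : ℝ) / N) (((j : ℕ) + 1 : ℝ) / N)

lemma Kgreen_one_sub (x y : ℝ) : Kgreen (1 - x) (1 - y) = Kgreen x y := by
  unfold Kgreen
  split_ifs with h1 h2 h2
  · have : x = y := by linarith
    subst this; ring
  · ring
  · ring
  · exfalso; linarith

lemma Kgreen_nonneg {x y : ℝ} (hx : x ∈ Icc (0:ℝ) 1) (hy : y ∈ Icc (0:ℝ) 1) :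
    0 ≤ Kgreen x y := by
  obtain ⟨hx0, hx1⟩ := hx
  obtain ⟨hy0, hy1⟩ := hy
  unfold Kgreen
  split_ifs with h
  · have : 0 ≤ x * (1 - y) := mul_nonneg hx0 (by linarith)
    have : 0 ≤ 2 * x * (1 - y) + x - y := by linarith
    positivity
  · have : 0 ≤ y * (1 - x) := mul_nonneg hy0 (by linarith)
    have : 0 ≤ 2 * y * (1 - x) + y - x := by linarith
    positivity

lemma le_Kgreen {x y : ℝ} (hx : x ∈ Icc (0:ℝ) 1) (hy : y ∈ Icc (0:ℝ) 1) :
    1 / 3 * (x ^ 2 * (1 - x) ^ 2) * (y ^ 2 * (1 - y) ^ 2) ≤ Kgreen x y := by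
  obtain ⟨hx0, hx1⟩ := hx
  obtain ⟨hy0, hy1⟩ := hy
  unfold Kgreen
  split_ifs with h
  · have h1 : 0 ≤ x * (1 - y) := mul_nonneg hx0 (by linarith)
    have h2 : x * (1 - y) ≤ 1 := by nlinarith
    have h3 : 2 * (x * (1 - y)) ^ 2 ≤ 2 * x * (1 - y) + x - y := by nlinarith
    have h4 : 0 ≤ 1 / 6 * (1 - x) ^ 2 * y ^ 2 := by positivity
    calc _ = 1 / 6 * (1 - x) ^ 2 * y ^ 2 * (2 * (x * (1 - y)) ^ 2) := by ring
      _ ≤ _ := mul_le_mul_of_nonneg_left h3 h4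
  · have h1 : 0 ≤ y * (1 - x) := mul_nonneg hy0 (by linarith)
    have h2 : y * (1 - x) ≤ 1 := by nlinarith
    have h3 : 2 * (y * (1 - x)) ^ 2 ≤ 2 * y * (1 - x) + y - x := by nlinarith
    have h4 : 0 ≤ 1 / 6 * x ^ 2 * (1 - y) ^ 2 := by positivity
    calc _ = 1 / 6 * x ^ 2 * (1 - y) ^ 2 * (2 * (y * (1 - x)) ^ 2) := by ring
      _ ≤ _ := mul_le_mul_of_nonneg_left h3 h4

lemma Kgreen_zero_right {x : ℝ} (hx : 0 ≤ x) : Kgreen x 0 = 0 := by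
  simp [Kgreen, hx]

lemma continuous_Kgreen (x : ℝ) : Continuous (Kgreen x) := by
  unfold Kgreen
  refine Continuous.if_le (by fun_prop) (by fun_prop) (by fun_prop) (by fun_prop) ?_
  rintro y rfl
  ring

lemma abs_Kgreen_sub_le_of_le {x y z : ℝ} (hx1 : x ≤ 1) (hy0 : 0 ≤ y) (hz0 : 0 ≤ z)
    (hyx : y ≤ x) (hzx : z ≤ x) :
    |Kgreen x y - Kgreen x z| ≤ 3 * (x ^ 2 * (1 - x) ^ 2) * |y - z| := by
  have hx0 : 0 ≤ x := hy0.trans hyx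
  have hyy : y * y ≤ x * x := mul_self_le_mul_self hy0 hyx
  have hzz : z * z ≤ x * x := mul_self_le_mul_self hz0 hzx
  have hyz : y * z ≤ x * x := mul_le_mul hyx hzx hz0 hx0
  have hxy : x * y ≤ x * x := mul_le_mul_of_nonneg_left hyx hx0
  have hxz : x * z ≤ x * x := mul_le_mul_of_nonneg_left hzx hx0
  set S := y * y + y * z + z * z with hS
  have hS0 : 0 ≤ S := by positivity
  have hxS : x * S ≤ S := mul_le_of_le_one_left hS0 hx1
  have hxS0 : 0 ≤ x * S := mul_nonneg hx0 hS0
  have hxy0 : 0 ≤ x * y := mul_nonneg hx0 hy0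
  have hxz0 : 0 ≤ x * z := mul_nonneg hx0 hz0
  have key : Kgreen x y - Kgreen x z =
      (1 / 6 * (1 - x) ^ 2) * (3 * (x * y + x * z) - (S + 2 * (x * S))) * (y - z) := by
    simp only [Kgreen, hyx, hzx, if_true, hS]; ring
  have hb : |3 * (x * y + x * z) - (S + 2 * (x * S))| ≤ 18 * (x * x) := by
    rw [abs_le]; constructor <;> nlinarith
  rw [key, abs_mul, abs_mul, abs_of_nonneg (by positivity : 0 ≤ 1 / 6 * (1 - x) ^ 2)]
  refine mul_le_mul_of_nonneg_right ?_ (abs_nonneg _)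
  calc _ ≤ 1 / 6 * (1 - x) ^ 2 * (18 * (x * x)) :=
        mul_le_mul_of_nonneg_left hb (by positivity)
    _ = _ := by ring

lemma abs_Kgreen_sub_le_of_ge {x y z : ℝ} (hx0 : 0 ≤ x) (hy1 : y ≤ 1) (hz1 : z ≤ 1)
    (hyx : x ≤ y) (hzx : x ≤ z) :
    |Kgreen x y - Kgreen x z| ≤ 3 * (x ^ 2 * (1 - x) ^ 2) * |y - z| := by
  have h := abs_Kgreen_sub_le_of_le (x := 1 - x) (y := 1 - y) (z := 1 - z)
    (by linarith) (by linarith) (by linarith) (by linarith) (by linarith)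
  rw [Kgreen_one_sub, Kgreen_one_sub] at h
  refine h.trans (le_of_eq ?_)
  rw [show 1 - y - (1 - z) = -(y - z) by ring, abs_neg]
  ring

lemma abs_Kgreen_sub_le {x y z : ℝ} (hx : x ∈ Icc (0:ℝ) 1) (hy : y ∈ Icc (0:ℝ) 1)
    (hz : z ∈ Icc (0:ℝ) 1) :
    |Kgreen x y - Kgreen x z| ≤ 3 * (x ^ 2 * (1 - x) ^ 2) * |y - z| := by
  wlog h : y ≤ z generalizing y z
  · rw [abs_sub_comm, abs_sub_comm y z]
    exact this hz hy (le_of_not_ge h)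
  rcases le_total z x with hzx | hxz
  · exact abs_Kgreen_sub_le_of_le hx.2 hy.1 hz.1 (h.trans hzx) hzx
  rcases le_total x y with hxy | hyx
  · exact abs_Kgreen_sub_le_of_ge hx.1 hy.2 hz.2 hxy hxz
  have h1 := abs_Kgreen_sub_le_of_le hx.2 hy.1 hx.1 hyx le_rfl
  have h2 := abs_Kgreen_sub_le_of_ge hx.1 hx.2 hz.2 le_rfl hxz
  rw [abs_of_nonpos (by linarith : y - x ≤ 0)] at h1
  rw [abs_of_nonpos (by linarith : x - z ≤ 0)] at h2
  rw [abs_of_nonpos (by linarith : y - z ≤ 0)]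
  calc _ ≤ |Kgreen x y - Kgreen x x| + |Kgreen x x - Kgreen x z| := abs_sub_le _ _ _
    _ ≤ _ := add_le_add h1 h2
    _ = _ := by ring

lemma Kgreen_le {x y : ℝ} (hx : x ∈ Icc (0:ℝ) 1) (hy : y ∈ Icc (0:ℝ) 1) :
    Kgreen x y ≤ 3 * (x ^ 2 * (1 - x) ^ 2) := by
  have h := abs_Kgreen_sub_le hx hy (z := 0) (by simp)
  rw [Kgreen_zero_right hx.1, sub_zero, sub_zero, abs_of_nonneg hy.1] at h
  exact (le_abs_self _).trans (h.trans (mul_le_of_le_one_right (by positivity) hy.2))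

/-- Green's representation of a clamped function by its fourth derivative. -/
lemma integral_Kgreen_mul {f₀ f₁ f₂ f₃ f₄ : ℝ → ℝ} (h₀ : ∀ x, HasDerivAt f₀ (f₁ x) x)
    (h₁ : ∀ x, HasDerivAt f₁ (f₂ x) x) (h₂ : ∀ x, HasDerivAt f₂ (f₃ x) x)
    (h₃ : ∀ x, HasDerivAt f₃ (f₄ x) x) (hc : Continuous f₄) (ha : f₀ 0 = 0) (ha' : f₁ 0 = 0)
    (hb : f₀ 1 = 0) (hb' : f₁ 1 = 0) {x : ℝ} (hx : x ∈ Icc (0:ℝ) 1) :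
    ∫ y in (0:ℝ)..1, Kgreen x y * f₄ y = f₀ x := by
  have hci : Continuous fun y => Kgreen x y * f₄ y := (continuous_Kgreen x).mul hc
  have cubic (a b c d s t : ℝ) :
      ∫ y in s..t, (a + b * y + c * y ^ 2 + d * y ^ 3) * f₄ y =
      ((a + b * t + c * t ^ 2 + d * t ^ 3) * f₃ t - (b + 2 * c * t + 3 * d * t ^ 2) * f₂ t
        + (2 * c + 6 * d * t) * f₁ t - 6 * d * f₀ t) -
      ((a + b * s + c * s ^ 2 + d * s ^ 3) * f₃ s - (b + 2 * c * s + 3 * d * s ^ 2) * f₂ s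
        + (2 * c + 6 * d * s) * f₁ s - 6 * d * f₀ s) := by
    refine intervalIntegral.integral_eq_sub_of_hasDerivAt
      (f := fun y => (a + b * y + c * y ^ 2 + d * y ^ 3) * f₃ y
        - (b + 2 * c * y + 3 * d * y ^ 2) * f₂ y
        + (2 * c + 6 * d * y) * f₁ y - 6 * d * f₀ y) (fun y _ => ?_)
      (Continuous.intervalIntegrable (by fun_prop) _ _)
    have p1 := hasDerivAt_id' y
    have p2 := hasDerivAt_pow 2 y
    have p3 := hasDerivAt_pow 3 y
    have q0 := (((p1.const_mul b).const_add a).add (p2.const_mul c)).add (p3.const_mul d)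
    have q1 := ((p1.const_mul (2 * c)).const_add b).add (p2.const_mul (3 * d))
    have q2 := (p1.const_mul (6 * d)).const_add (2 * c)
    refine ((((q0.mul (h₃ y)).sub (q1.mul (h₂ y))).add (q2.mul (h₁ y))).sub
      ((h₀ y).const_mul (6 * d))).congr_deriv ?_
    simp only [Pi.add_apply]
    push_cast
    ring
  rw [← intervalIntegral.integral_add_adjacent_intervals (hci.intervalIntegrable 0 x)
    (hci.intervalIntegrable x 1)]
  have e1 : ∫ y in (0:ℝ)..x, Kgreen x y * f₄ y = ∫ y in (0:ℝ)..x,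
      (0 + 0 * y + (1 - x) ^ 2 * x / 2 * y ^ 2 + -((1 - x) ^ 2 * (1 + 2 * x) / 6) * y ^ 3)
        * f₄ y := by
    refine intervalIntegral.integral_congr fun y hy => ?_
    rw [uIcc_of_le hx.1] at hy
    simp only [Kgreen, hy.2, if_true]
    ring
  have e2 : ∫ y in x..1, Kgreen x y * f₄ y = ∫ y in x..1,
      (-x ^ 3 / 6 + x ^ 2 / 2 * y + (x ^ 3 / 2 - x ^ 2) * y ^ 2 +
        (x ^ 2 / 2 - x ^ 3 / 3) * y ^ 3) * f₄ y := by
    refine intervalIntegral.integral_congr fun y hy => ?_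
    rw [uIcc_of_le hx.2] at hy
    rcases hy.1.eq_or_lt with h | h
    · subst h
      simp only [Kgreen, le_refl, if_true]
      ring
    · simp only [Kgreen, not_le.2 h, if_false]
      ring
  rw [e1, e2, cubic, cubic, ha, ha', hb, hb']
  ring

/-- Left Riemann sums of a Lipschitz function. -/
lemma abs_riemannSum_sub_integral_le {g : ℝ → ℝ} (hg : Continuous g) {L : ℝ} (hL : 0 ≤ L)
    (hlip : ∀ y ∈ Icc (0:ℝ) 1, ∀ z ∈ Icc (0:ℝ) 1, |g y - g z| ≤ L * |y - z|)
    {N : ℕ} (hN : 0 < N) :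
    |1 / (N:ℝ) * ∑ j ∈ Finset.range N, g (j / N) - ∫ y in (0:ℝ)..1, g y| ≤ L / N := by
  have hN' : (0:ℝ) < N := by exact_mod_cast hN
  have hsplit := intervalIntegral.sum_integral_adjacent_intervals
    (f := g) (μ := MeasureTheory.volume) (a := fun j : ℕ => (j:ℝ) / N) (n := N)
    fun k _ => hg.intervalIntegrable _ _
  simp only [Nat.cast_zero, zero_div, div_self hN'.ne'] at hsplit
  rw [← hsplit, Finset.mul_sum, ← Finset.sum_sub_distrib]
  have hterm : ∀ j ∈ Finset.range N,
      |1 / (N:ℝ) * g (j / N) - ∫ y in ((j:ℝ) / N)..((j + 1 : ℕ) : ℝ) / N, g y|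
        ≤ L / N * (1 / N) := by
    intro j hj
    have hlen : ((j + 1 : ℕ) : ℝ) / N - (j:ℝ) / N = 1 / N := by push_cast; ring
    have hjN : ((j + 1 : ℕ) : ℝ) ≤ N := by exact_mod_cast Finset.mem_range.1 hj
    have hle : (j:ℝ) / N ≤ ((j + 1 : ℕ) : ℝ) / N := by
      have : 0 ≤ 1 / (N:ℝ) := by positivity
      linarith
    have hj0 : 0 ≤ (j:ℝ) / N := by positivity
    have hj1 : ((j + 1 : ℕ) : ℝ) / N ≤ 1 := (div_le_one hN').2 hjN
    have hconst : 1 / (N:ℝ) * g (j / N) =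
        ∫ _ in ((j:ℝ) / N)..((j + 1 : ℕ) : ℝ) / N, g (j / N) := by
      rw [intervalIntegral.integral_const, hlen, smul_eq_mul]
    rw [hconst, ← intervalIntegral.integral_sub (by simp) (hg.intervalIntegrable _ _)]
    have := intervalIntegral.norm_integral_le_of_norm_le_const
      (a := (j:ℝ) / N) (b := ((j + 1 : ℕ) : ℝ) / N) (f := fun y => g (j / N) - g y)
      (C := L / N) (fun y hy => ?_)
    · rwa [hlen, Real.norm_eq_abs, abs_of_nonneg (by positivity : 0 ≤ 1 / (N:ℝ))] at this
    · rw [uIoc_of_le hle] at hy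
      rw [Real.norm_eq_abs]
      refine (hlip _ ⟨hj0, hle.trans hj1⟩ _ ⟨hj0.trans hy.1.le, hy.2.trans hj1⟩).trans ?_
      rw [div_eq_mul_one_div L]
      refine mul_le_mul_of_nonneg_left ?_ hL
      rw [abs_of_nonpos (by linarith [hy.1])]
      linarith [hy.2]
  calc _ ≤ ∑ j ∈ Finset.range N, _ := Finset.abs_sum_le_sum_abs _ _
    _ ≤ ∑ j ∈ Finset.range N, L / N * (1 / N) := Finset.sum_le_sum hterm
    _ = L / N := by
      rw [Finset.sum_const, Finset.card_range, nsmul_eq_mul]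
      field_simp

/-- `φ` is a (possibly zero) solution of the clamped eigenvalue problem for `lam`. -/
structure IsClampedSolution (lam : ℝ) (φ : ℝ → ℝ) : Prop where
  contDiff : ContDiff ℝ 4 φ
  eq : ∀ x ∈ Icc (0:ℝ) 1, iteratedDeriv 4 φ x = lam * φ x
  zero : φ 0 = 0
  deriv_zero : deriv φ 0 = 0
  one : φ 1 = 0
  deriv_one : deriv φ 1 = 0

namespace IsClampedSolution

variable {lam : ℝ} {φ : ℝ → ℝ}

lemma hasDerivAt_iteratedDeriv (h : IsClampedSolution lam φ) {k : ℕ} (hk : k < 4) (x : ℝ) :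
    HasDerivAt (iteratedDeriv k φ) (iteratedDeriv (k + 1) φ x) x := by
  rw [iteratedDeriv_succ]
  exact (h.contDiff.differentiable_iteratedDeriv k (by exact_mod_cast hk) x).hasDerivAt

lemma integral_eq (h : IsClampedSolution lam φ) {x : ℝ} (hx : x ∈ Icc (0:ℝ) 1) :
    lam * ∫ y in (0:ℝ)..1, Kgreen x y * φ y = φ x := by
  have key := integral_Kgreen_mul (h.hasDerivAt_iteratedDeriv (k := 0) (by norm_num))
    (h.hasDerivAt_iteratedDeriv (k := 1) (by norm_num))
    (h.hasDerivAt_iteratedDeriv (k := 2) (by norm_num))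
    (h.hasDerivAt_iteratedDeriv (k := 3) (by norm_num))
    (h.contDiff.continuous_iteratedDeriv 4 le_rfl)
    (by simpa using h.zero) (by simpa using h.deriv_zero)
    (by simpa using h.one) (by simpa using h.deriv_one) hx
  rw [iteratedDeriv_zero] at key
  rw [← key, ← intervalIntegral.integral_const_mul]
  refine intervalIntegral.integral_congr fun y hy => ?_
  rw [uIcc_of_le zero_le_one] at hy
  change _ = Kgreen x y * iteratedDeriv 4 φ y
  rw [h.eq y hy]
  ring

lemma continuous (h : IsClampedSolution lam φ) : Continuous φ := h.contDiff.continuous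

lemma eigenvalue_pos (h : IsClampedSolution lam φ) (hne : ∃ x ∈ Icc (0:ℝ) 1, φ x ≠ 0) :
    0 < lam := by
  obtain ⟨x, hx, hφx⟩ := hne
  have hc : ∀ k ≤ 4, Continuous (iteratedDeriv k φ) := fun k hk =>
    h.contDiff.continuous_iteratedDeriv k (by exact_mod_cast hk)
  have hc2 := hc 2 (by norm_num)
  have hc4 := hc 4 le_rfl
  have hφ := h.continuous
  have hint : ∫ y in (0:ℝ)..1, (iteratedDeriv 4 φ y * φ y - iteratedDeriv 2 φ y ^ 2) = 0 := by
    have := intervalIntegral.integral_eq_sub_of_hasDerivAt (a := 0) (b := 1)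
      (f := fun y => iteratedDeriv 3 φ y * φ y - iteratedDeriv 2 φ y * deriv φ y)
      (f' := fun y => iteratedDeriv 4 φ y * φ y - iteratedDeriv 2 φ y ^ 2)
      (fun y _ => ?_) (Continuous.intervalIntegrable (by fun_prop) _ _)
    · rw [this]
      simp [h.zero, h.deriv_zero, h.one, h.deriv_one]
    · have d0 := h.hasDerivAt_iteratedDeriv (k := 0) (by norm_num) y
      have d1 := h.hasDerivAt_iteratedDeriv (k := 1) (by norm_num) y
      have d2 := h.hasDerivAt_iteratedDeriv (k := 2) (by norm_num) y
      have d3 := h.hasDerivAt_iteratedDeriv (k := 3) (by norm_num) y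
      rw [iteratedDeriv_zero, zero_add, iteratedDeriv_one] at d0
      rw [iteratedDeriv_one] at d1
      refine ((d3.mul d0).sub (d2.mul d1)).congr_deriv ?_
      ring
  rw [intervalIntegral.integral_sub (Continuous.intervalIntegrable (by fun_prop) _ _)
    (Continuous.intervalIntegrable (by fun_prop) _ _)] at hint
  have he : ∫ y in (0:ℝ)..1, iteratedDeriv 4 φ y * φ y = lam * ∫ y in (0:ℝ)..1, φ y ^ 2 := by
    rw [← intervalIntegral.integral_const_mul]
    refine intervalIntegral.integral_congr fun y hy => ?_
    rw [uIcc_of_le zero_le_one] at hy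
    rw [h.eq y hy]
    ring
  have hpos : 0 < ∫ y in (0:ℝ)..1, φ y ^ 2 :=
    intervalIntegral.integral_pos zero_lt_one (by fun_prop) (fun y _ => sq_nonneg _)
      ⟨x, hx, by positivity⟩
  have hnn : 0 ≤ ∫ y in (0:ℝ)..1, iteratedDeriv 2 φ y ^ 2 :=
    intervalIntegral.integral_nonneg zero_le_one fun y _ => sq_nonneg _
  rcases lt_trichotomy lam 0 with hl | hl | hl
  · nlinarith
  · have := h.integral_eq hx
    rw [hl, zero_mul] at this
    exact absurd this.symm hφx
  · exact hl

lemma abs_le_integral (h : IsClampedSolution lam φ) {g : ℝ → ℝ} (hg : Continuous g)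
    (hφg : ∀ y ∈ Icc (0:ℝ) 1, |φ y| ≤ g y) {x : ℝ} (hx : x ∈ Icc (0:ℝ) 1) :
    |φ x| ≤ |lam| * ∫ y in (0:ℝ)..1, Kgreen x y * g y := by
  have hφ := h.continuous
  have hK := continuous_Kgreen x
  rw [← h.integral_eq hx, abs_mul]
  refine mul_le_mul_of_nonneg_left ?_ (abs_nonneg _)
  refine (intervalIntegral.abs_integral_le_integral_abs zero_le_one).trans ?_
  refine intervalIntegral.integral_mono_on zero_le_one
    (Continuous.intervalIntegrable (by fun_prop) _ _)
    (Continuous.intervalIntegrable (by fun_prop) _ _) fun y hy => ?_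
  rw [abs_mul, abs_of_nonneg (Kgreen_nonneg hx hy)]
  exact mul_le_mul_of_nonneg_left (hφg y hy) (Kgreen_nonneg hx hy)

lemma exists_abs_le (h : IsClampedSolution lam φ) :
    ∃ D, 0 ≤ D ∧ ∀ x ∈ Icc (0:ℝ) 1, |φ x| ≤ D * (x ^ 2 * (1 - x) ^ 2) := by
  obtain ⟨B, hB⟩ := isCompact_Icc.exists_bound_of_continuousOn
    (s := Icc (0:ℝ) 1) h.continuous.continuousOn
  have hB0 : 0 ≤ B := (norm_nonneg _).trans (hB 0 (by simp))
  refine ⟨|lam| * (3 * B), by positivity, fun x hx => ?_⟩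
  refine (h.abs_le_integral continuous_const hB hx).trans ?_
  rw [mul_assoc]
  refine mul_le_mul_of_nonneg_left ?_ (abs_nonneg _)
  have hK := continuous_Kgreen x
  have := intervalIntegral.integral_mono_on (μ := MeasureTheory.volume) (a := (0:ℝ)) (b := 1)
    zero_le_one
    (f := fun y => Kgreen x y * B) (g := fun _ => 3 * (x ^ 2 * (1 - x) ^ 2) * B)
    (Continuous.intervalIntegrable (by fun_prop) _ _)
    (Continuous.intervalIntegrable (by fun_prop) _ _)
    (fun y hy => mul_le_mul_of_nonneg_right (Kgreen_le hx hy) hB0)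
  refine this.trans (le_of_eq ?_)
  rw [intervalIntegral.integral_const]
  simp only [sub_zero, smul_eq_mul]
  ring

lemma exists_le_of_nonneg (h : IsClampedSolution lam φ) (hne : ∃ x ∈ Icc (0:ℝ) 1, φ x ≠ 0)
    (hnn : ∀ x ∈ Icc (0:ℝ) 1, 0 ≤ φ x) :
    ∃ c, 0 < c ∧ ∀ x ∈ Icc (0:ℝ) 1, c * (x ^ 2 * (1 - x) ^ 2) ≤ φ x := by
  have hlam := h.eigenvalue_pos hne
  have hφ := h.continuous
  obtain ⟨z, hz, hφz⟩ := hne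
  have hz0 : z ≠ 0 := by
    rintro rfl
    exact hφz h.zero
  have hz1 : 1 - z ≠ 0 := by
    intro hz1
    obtain rfl : z = 1 := by linarith
    exact hφz h.one
  have hφz' : 0 < φ z := lt_of_le_of_ne (hnn z hz) hφz.symm
  have hpos : 0 < ∫ y in (0:ℝ)..1, y ^ 2 * (1 - y) ^ 2 * φ y := by
    refine intervalIntegral.integral_pos zero_lt_one (by fun_prop) (fun y hy => ?_)
      ⟨z, hz, by positivity⟩
    have := hnn y (Ioc_subset_Icc_self hy)
    positivity
  refine ⟨lam * (1 / 3 * ∫ y in (0:ℝ)..1, y ^ 2 * (1 - y) ^ 2 * φ y), by positivity,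
    fun x hx => ?_⟩
  have hK := continuous_Kgreen x
  have := intervalIntegral.integral_mono_on (μ := MeasureTheory.volume) (a := (0:ℝ)) (b := 1)
    zero_le_one
    (f := fun y => 1 / 3 * (x ^ 2 * (1 - x) ^ 2) * (y ^ 2 * (1 - y) ^ 2 * φ y))
    (g := fun y => Kgreen x y * φ y)
    (Continuous.intervalIntegrable (by fun_prop) _ _)
    (Continuous.intervalIntegrable (by fun_prop) _ _)
    (fun y hy => by
      rw [← mul_assoc]
      exact mul_le_mul_of_nonneg_right (le_Kgreen hx hy) (hnn y hy))
  rw [intervalIntegral.integral_const_mul] at this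
  rw [← h.integral_eq hx]
  calc _ = lam * (1 / 3 * (x ^ 2 * (1 - x) ^ 2) *
        ∫ y in (0:ℝ)..1, y ^ 2 * (1 - y) ^ 2 * φ y) := by ring
    _ ≤ _ := mul_le_mul_of_nonneg_left this hlam.le

/-- An eigenvalue with a nonnegative eigenfunction is minimal in modulus. -/
lemma le_abs_of_nonneg {lam' : ℝ} {u : ℝ → ℝ} (hu : IsClampedSolution lam u)
    (hune : ∃ x ∈ Icc (0:ℝ) 1, u x ≠ 0) (hnn : ∀ x ∈ Icc (0:ℝ) 1, 0 ≤ u x)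
    (hφ : IsClampedSolution lam' φ) (hφne : ∃ x ∈ Icc (0:ℝ) 1, φ x ≠ 0) :
    lam ≤ |lam'| := by
  have hlam := hu.eigenvalue_pos hune
  obtain ⟨c, hc, hcu⟩ := hu.exists_le_of_nonneg hune hnn
  obtain ⟨D, hD, hDφ⟩ := hφ.exists_abs_le
  by_contra! hlt
  have huc := hu.continuous
  have hiter : ∀ n : ℕ, ∀ x ∈ Icc (0:ℝ) 1, |φ x| ≤ (|lam'| / lam) ^ n * (D / c) * u x := by
    intro n
    induction n with
    | zero =>
      intro x hx
      calc |φ x| ≤ D * (x ^ 2 * (1 - x) ^ 2) := hDφ x hx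
        _ = D / c * (c * (x ^ 2 * (1 - x) ^ 2)) := by field_simp
        _ ≤ D / c * u x := mul_le_mul_of_nonneg_left (hcu x hx) (by positivity)
        _ = _ := by ring
    | succ n ih =>
      intro x hx
      refine (hφ.abs_le_integral (by fun_prop) ih hx).trans (le_of_eq ?_)
      have e := hu.integral_eq hx
      rw [← e]
      simp_rw [mul_left_comm (Kgreen x _), intervalIntegral.integral_const_mul, pow_succ]
      field_simp
  obtain ⟨x, hx, hφx⟩ := hφne
  have hlim : Tendsto (fun n : ℕ => (|lam'| / lam) ^ n * (D / c) * u x) atTop (nhds 0) := by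
    have := tendsto_pow_atTop_nhds_zero_of_lt_one (r := |lam'| / lam) (by positivity)
      ((div_lt_one hlam).2 hlt)
    simpa using (this.mul_const (D / c)).mul_const (u x)
  have := ge_of_tendsto' hlim fun n => hiter n x hx
  exact hφx (abs_eq_zero.1 (le_antisymm this (abs_nonneg _)))

lemma exists_lipschitz (h : IsClampedSolution lam φ) :
    ∃ L, 0 ≤ L ∧ ∀ x ∈ Icc (0:ℝ) 1, ∀ y ∈ Icc (0:ℝ) 1, |φ x - φ y| ≤ L * |x - y| := by
  obtain ⟨L, hL⟩ := isCompact_Icc.exists_bound_of_continuousOn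
    (s := Icc (0:ℝ) 1) (h.contDiff.continuous_deriv (by norm_num)).continuousOn
  refine ⟨L, (norm_nonneg _).trans (hL 0 (by simp)), fun x hx y hy => ?_⟩
  exact (convex_Icc (0:ℝ) 1).norm_image_sub_le_of_norm_deriv_le
    (fun z _ => h.contDiff.differentiable (by norm_num) z) hL hy hx

/-- Consistency of the quadrature of Green's operator at an eigenfunction. -/
lemma exists_abs_riemannSum_sub_le (h : IsClampedSolution lam φ) (hlam : lam ≠ 0) :
    ∃ C, 0 ≤ C ∧ ∀ N : ℕ, 0 < N → ∀ x ∈ Icc (0:ℝ) 1,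
      |1 / (N:ℝ) * ∑ j ∈ Finset.range N, Kgreen x (j / N) * φ (j / N) - lam⁻¹ * φ x|
        ≤ C / N * (x ^ 2 * (1 - x) ^ 2) := by
  obtain ⟨L, hL0, hL⟩ := h.exists_lipschitz
  obtain ⟨B, hB⟩ := isCompact_Icc.exists_bound_of_continuousOn
    (s := Icc (0:ℝ) 1) h.continuous.continuousOn
  have hB0 : 0 ≤ B := (norm_nonneg _).trans (hB 0 (by simp))
  refine ⟨3 * (B + L), by positivity, fun N hN x hx => ?_⟩
  rw [← h.integral_eq hx, inv_mul_cancel_left₀ hlam]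
  refine (abs_riemannSum_sub_integral_le (L := 3 * (x ^ 2 * (1 - x) ^ 2) * (B + L))
    ((continuous_Kgreen x).mul h.continuous) (by positivity) (fun y hy z hz => ?_) hN).trans
    (le_of_eq (by ring))
  have e : Kgreen x y * φ y - Kgreen x z * φ z =
      (Kgreen x y - Kgreen x z) * φ y + Kgreen x z * (φ y - φ z) := by ring
  rw [Pi.mul_apply, Pi.mul_apply, e]
  refine (abs_add_le _ _).trans ?_
  rw [abs_mul, abs_mul, abs_of_nonneg (Kgreen_nonneg hx hz)]
  have h1 := mul_le_mul (abs_Kgreen_sub_le hx hy hz) (hB y hy) (norm_nonneg _) (by positivity)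
  have h2 := mul_le_mul (Kgreen_le hx hz) (hL y hy z hz) (abs_nonneg _) (by positivity)
  rw [Real.norm_eq_abs] at h1
  linarith

end IsClampedSolution

/-- Combinations of trigonometric and hyperbolic functions of `k * x - m`. -/
noncomputable def trigHyp (k m a b c d : ℝ) (x : ℝ) : ℝ :=
  a * Real.cos (k * x - m) + b * Real.sin (k * x - m) +
    c * Real.cosh (k * x - m) + d * Real.sinh (k * x - m)

lemma deriv_trigHyp (k m a b c d : ℝ) :
    deriv (trigHyp k m a b c d) = trigHyp k m (k * b) (-(k * a)) (k * d) (k * c) := by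
  funext x
  have hl : HasDerivAt (fun x : ℝ => k * x - m) k x := by
    simpa using ((hasDerivAt_id' x).const_mul k).sub_const m
  have := (((hl.cos.const_mul a).add (hl.sin.const_mul b)).add (hl.cosh.const_mul c)).add
    (hl.sinh.const_mul d)
  refine (this.congr_deriv ?_).deriv
  unfold trigHyp
  ring

lemma iteratedDeriv_four_trigHyp (k m a b c d x : ℝ) :
    iteratedDeriv 4 (trigHyp k m a b c d) x = k ^ 4 * trigHyp k m a b c d x := by
  simp only [iteratedDeriv_succ', deriv_trigHyp, iteratedDeriv_zero]
  unfold trigHyp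
  ring

lemma contDiff_trigHyp (k m a b c d : ℝ) : ContDiff ℝ 4 (trigHyp k m a b c d) := by
  unfold trigHyp
  fun_prop

lemma exists_sin_mul_cosh_add_eq_zero :
    ∃ m ∈ Ioo (Real.pi / 2) Real.pi,
      Real.sin m * Real.cosh m + Real.cos m * Real.sinh m = 0 := by
  have hpi := Real.pi_pos
  have := intermediate_value_Ioo' (a := Real.pi / 2) (b := Real.pi) (by linarith)
    (f := fun m => Real.sin m * Real.cosh m + Real.cos m * Real.sinh m) (by fun_prop)
  obtain ⟨m, hm, h⟩ := this (a := 0) ⟨by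
    have := Real.sinh_pos_iff.2 hpi
    simpa using this, by
    have := Real.cosh_pos (Real.pi / 2)
    simpa using this⟩
  exact ⟨m, hm, h⟩

lemma convexOn_sinh : ConvexOn ℝ (Ici 0) Real.sinh := by
  refine MonotoneOn.convexOn_of_deriv (convex_Ici 0) (by fun_prop)
    Real.differentiable_sinh.differentiableOn ?_
  rw [Real.deriv_sinh, interior_Ici]
  intro x hx y hy hxy
  exact Real.cosh_le_cosh.2 (by rwa [abs_of_pos hx, abs_of_pos hy])

lemma cosh_mul_cos_sub_nonneg {m : ℝ} (hm : m ∈ Ioo (Real.pi / 2) Real.pi)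
    (h0 : Real.sin m * Real.cosh m + Real.cos m * Real.sinh m = 0) {t : ℝ} (ht : |t| ≤ m) :
    0 ≤ Real.cosh m * Real.cos t - Real.cos m * Real.cosh t := by
  have hm0 : 0 < m := Real.pi_div_two_pos.trans hm.1
  have hsm : 0 < Real.sinh m := Real.sinh_pos_iff.2 hm0
  have hanti : AntitoneOn (fun t => Real.cosh m * Real.cos t - Real.cos m * Real.cosh t)
      (Icc 0 m) := by
    refine antitoneOn_of_deriv_nonpos (convex_Icc 0 m) (by fun_prop) (by fun_prop)
      fun u hu => ?_
    rw [interior_Icc] at hu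
    have hd : deriv (fun t => Real.cosh m * Real.cos t - Real.cos m * Real.cosh t) u =
        Real.cosh m * (-Real.sin u) - Real.cos m * Real.sinh u :=
      (((Real.hasDerivAt_cos u).const_mul _).sub
        ((Real.hasDerivAt_cosh u).const_mul _)).deriv
    rw [hd]
    have hr : 0 ≤ u / m := div_nonneg hu.1.le hm0.le
    have hr1 : 0 ≤ 1 - u / m := by
      rw [sub_nonneg, div_le_one hm0]
      exact hu.2.le
    have h1 := strictConcaveOn_sin_Icc.concaveOn.2
      (show (0:ℝ) ∈ Icc 0 Real.pi from ⟨le_rfl, Real.pi_pos.le⟩)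
      (show m ∈ Icc 0 Real.pi from ⟨hm0.le, hm.2.le⟩) hr1 hr (by ring)
    have h2 := convexOn_sinh.2 (show (0:ℝ) ∈ Ici 0 from self_mem_Ici)
      (show m ∈ Ici 0 from hm0.le) hr1 hr (by ring)
    simp only [smul_eq_mul, mul_zero, zero_add, Real.sin_zero, Real.sinh_zero,
      div_mul_cancel₀ u hm0.ne'] at h1 h2
    have hs : 0 ≤ Real.sin m := (Real.sin_pos_of_pos_of_lt_pi hm0 hm.2).le
    have h3 : Real.sin m * Real.sinh u ≤ Real.sinh m * Real.sin u :=
      calc _ ≤ Real.sin m * (u / m * Real.sinh m) := mul_le_mul_of_nonneg_left h2 hs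
        _ = Real.sinh m * (u / m * Real.sin m) := by ring
        _ ≤ _ := mul_le_mul_of_nonneg_left h1 hsm.le
    have h4 : Real.sinh m * (Real.cosh m * (-Real.sin u) - Real.cos m * Real.sinh u) ≤ 0 := by
      have : Real.sinh m * (Real.cosh m * (-Real.sin u) - Real.cos m * Real.sinh u) =
          Real.cosh m * (Real.sin m * Real.sinh u - Real.sinh m * Real.sin u) := by
        linear_combination -Real.sinh u * h0
      rw [this]
      exact mul_nonpos_of_nonneg_of_nonpos (Real.cosh_pos m).le (by linarith)
    exact nonpos_of_mul_nonpos_right h4 hsm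
  have := hanti ⟨abs_nonneg t, ht⟩ ⟨hm0.le, le_rfl⟩ ht
  simp only [Real.cos_abs, Real.cosh_abs] at this
  linarith

lemma exists_nonneg_isClampedSolution :
    ∃ (lam : ℝ) (u : ℝ → ℝ), IsClampedSolution lam u ∧ (∃ x ∈ Icc (0:ℝ) 1, u x ≠ 0) ∧
      ∀ x ∈ Icc (0:ℝ) 1, 0 ≤ u x := by
  obtain ⟨m, hm, h0⟩ := exists_sin_mul_cosh_add_eq_zero
  have hm0 : 0 < m := Real.pi_div_two_pos.trans hm.1
  have hcos : Real.cos m < 0 :=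
    Real.cos_neg_of_pi_div_two_lt_of_lt hm.1 (by linarith [hm.2, Real.pi_pos])
  refine ⟨(2 * m) ^ 4, trigHyp (2 * m) m (Real.cosh m) 0 (-Real.cos m) 0,
    ⟨contDiff_trigHyp _ _ _ _ _ _, fun x _ => iteratedDeriv_four_trigHyp _ _ _ _ _ _ _,
      ?_, ?_, ?_, ?_⟩, ⟨1 / 2, by norm_num, ?_⟩, fun x hx => ?_⟩
  · simp only [trigHyp, mul_zero, zero_sub, Real.cos_neg, Real.cosh_neg]
    ring
  · rw [deriv_trigHyp]
    simp only [trigHyp, mul_zero, zero_sub, Real.cos_neg, Real.cosh_neg, Real.sin_neg,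
      Real.sinh_neg]
    linear_combination 2 * m * h0
  · simp only [trigHyp, mul_one, show 2 * m - m = m by ring]
    ring
  · rw [deriv_trigHyp]
    simp only [trigHyp, mul_one, show 2 * m - m = m by ring]
    linear_combination -2 * m * h0
  · have h1 := Real.cosh_pos m
    simp only [trigHyp, show 2 * m * (1 / 2) - m = 0 by ring, Real.cos_zero, Real.cosh_zero]
    apply ne_of_gt
    linarith
  · have ht : |2 * m * x - m| ≤ m := by
      rw [abs_le]
      constructor <;> nlinarith [hx.1, hx.2]
    have := cosh_mul_cos_sub_nonneg hm h0 ht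
    simp only [trigHyp]
    linarith

namespace Matrix.IsHermitian

open Matrix

/-- Collatz–Wielandt upper bound for the eigenvalues of a nonnegative symmetric matrix. -/
lemma eigenvalues_le_of_mulVec_le {ι : Type*} [Fintype ι] [DecidableEq ι] {A : Matrix ι ι ℝ}
    (hA : A.IsHermitian) (hA0 : ∀ i j, 0 ≤ A i j) {u : ι → ℝ} (hu : ∀ i, 0 < u i)
    {r : ℝ} (hr : ∀ i, (A *ᵥ u) i ≤ r * u i) (k : ι) : hA.eigenvalues k ≤ r := by
  set v : ι → ℝ := ⇑(hA.eigenvectorBasis k) with hv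
  have hev : A *ᵥ v = hA.eigenvalues k • v := hA.mulVec_eigenvectorBasis k
  obtain ⟨i, -, hi⟩ := Finset.exists_max_image Finset.univ (fun i => |v i| / u i) ⟨k, by simp⟩
  set M := |v i| / u i with hM
  have hvM : ∀ j, |v j| ≤ M * u j := fun j => (div_le_iff₀ (hu j)).1 (hi j (by simp))
  have hvi : |v i| = M * u i := by rw [hM, div_mul_cancel₀ _ (hu i).ne']
  have hM0 : 0 ≤ M := div_nonneg (abs_nonneg _) (hu i).le
  have hMpos : 0 < M := by
    refine lt_of_le_of_ne hM0 fun h => ?_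
    apply hA.eigenvectorBasis.orthonormal.ne_zero k
    ext j
    have := hvM j
    rw [← h, zero_mul] at this
    exact abs_eq_zero.1 (le_antisymm this (abs_nonneg _))
  have h1 : |hA.eigenvalues k| * |v i| ≤ M * (r * u i) := by
    rw [← abs_mul, ← smul_eq_mul, ← Pi.smul_apply, ← hev]
    calc |(A *ᵥ v) i| ≤ ∑ j, |A i j * v j| := Finset.abs_sum_le_sum_abs _ _
      _ ≤ ∑ j, M * (A i j * u j) := Finset.sum_le_sum fun j _ => by
          rw [abs_mul, abs_of_nonneg (hA0 i j), mul_left_comm]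
          exact mul_le_mul_of_nonneg_left (hvM j) (hA0 i j)
      _ = M * (A *ᵥ u) i := (Finset.mul_sum _ _ _).symm
      _ ≤ _ := mul_le_mul_of_nonneg_left (hr i) hM0
  rw [hvi] at h1
  have h2 : |hA.eigenvalues k| * (M * u i) ≤ r * (M * u i) := by linarith
  exact (le_abs_self _).trans (le_of_mul_le_mul_right h2 (mul_pos hMpos (hu i)))

/-- Rayleigh quotients are bounded by any upper bound of the eigenvalues. -/
lemma dotProduct_mulVec_le {ι : Type*} [Fintype ι] [DecidableEq ι] {A : Matrix ι ι ℝ}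
    (hA : A.IsHermitian) {s : ℝ} (hs : ∀ k, hA.eigenvalues k ≤ s) (u : ι → ℝ) :
    u ⬝ᵥ A *ᵥ u ≤ s * (u ⬝ᵥ u) := by
  have hinner (w z : ι → ℝ) : inner ℝ (WithLp.toLp 2 w) (WithLp.toLp 2 z) = z ⬝ᵥ w := by
    simp [EuclideanSpace.inner_toLp_toLp]
  have hdiag (k : ι) : inner ℝ (hA.eigenvectorBasis k) (WithLp.toLp 2 (A *ᵥ u)) =
      hA.eigenvalues k * inner ℝ (hA.eigenvectorBasis k) (WithLp.toLp 2 u) := by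
    have h1 := hinner (⇑(hA.eigenvectorBasis k)) (A *ᵥ u)
    have h2 := hinner (⇑(hA.eigenvectorBasis k)) u
    rw [WithLp.toLp_ofLp] at h1 h2
    rw [h1, h2, dotProduct_comm, dotProduct_mulVec, ← mulVec_transpose]
    have ht : Aᵀ = A := by simpa using hA.eq
    rw [ht, hA.mulVec_eigenvectorBasis k, smul_dotProduct, dotProduct_comm, smul_eq_mul]
  rw [dotProduct_comm, ← hinner u (A *ᵥ u), ← hinner u u,
    ← hA.eigenvectorBasis.sum_inner_mul_inner (WithLp.toLp 2 u) (WithLp.toLp 2 (A *ᵥ u)),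
    ← hA.eigenvectorBasis.sum_inner_mul_inner (WithLp.toLp 2 u) (WithLp.toLp 2 u),
    Finset.mul_sum]
  refine Finset.sum_le_sum fun k _ => ?_
  rw [hdiag, real_inner_comm]
  nlinarith [mul_le_mul_of_nonneg_right (hs k)
    (mul_self_nonneg (inner ℝ (hA.eigenvectorBasis k) (WithLp.toLp 2 u)))]

/-- A positive approximate eigenvector of a nonnegative symmetric matrix locates its largest
eigenvalue. -/
lemma abs_iSup_eigenvalues_sub_le {ι : Type*} [Fintype ι] [DecidableEq ι] [Nonempty ι]
    {A : Matrix ι ι ℝ} (hA : A.IsHermitian) (hA0 : ∀ i j, 0 ≤ A i j) {u : ι → ℝ}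
    (hu : ∀ i, 0 < u i) {μ ε : ℝ} (h : ∀ i, |(A *ᵥ u) i - μ * u i| ≤ ε * u i) :
    |(⨆ k, hA.eigenvalues k) - μ| ≤ ε := by
  have hupper : (⨆ k, hA.eigenvalues k) ≤ μ + ε :=
    ciSup_le (hA.eigenvalues_le_of_mulVec_le hA0 hu fun i => by
      linarith [(abs_le.1 (h i)).2])
  have hlower := hA.dotProduct_mulVec_le
    (fun k => le_ciSup (Set.finite_range hA.eigenvalues).bddAbove k) u
  have huu : 0 < u ⬝ᵥ u :=
    Finset.sum_pos (fun i _ => mul_pos (hu i) (hu i)) Finset.univ_nonempty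
  have hle : (μ - ε) * (u ⬝ᵥ u) ≤ u ⬝ᵥ A *ᵥ u := by
    rw [← smul_eq_mul, ← dotProduct_smul]
    refine Finset.sum_le_sum fun i _ => mul_le_mul_of_nonneg_left ?_ (hu i).le
    rw [Pi.smul_apply, smul_eq_mul]
    linarith [(abs_le.1 (h i)).1]
  have := le_of_mul_le_mul_right (hle.trans hlower) huu
  rw [abs_le]
  constructor <;> linarith

end Matrix.IsHermitian

lemma Kmat_mulVec {n : ℕ} {u : ℝ → ℝ} (hu : u 0 = 0) (i : Fin (n + 1 - 1)) :
    Matrix.mulVec (Kmat (n + 1)) (fun j => u (((j : ℕ) + 1 : ℝ) / (n + 1 : ℕ))) i =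
      1 / ((n + 1 : ℕ) : ℝ) * ∑ j ∈ Finset.range (n + 1),
        Kgreen (((i : ℕ) + 1 : ℝ) / (n + 1 : ℕ)) (j / (n + 1 : ℕ)) * u (j / (n + 1 : ℕ)) := by
  rw [Finset.sum_range_succ']
  simp only [Nat.cast_zero, zero_div, hu, mul_zero, add_zero]
  rw [Matrix.mulVec, dotProduct, Finset.mul_sum, ← Fin.sum_univ_eq_sum_range
    (fun j => 1 / ((n + 1 : ℕ) : ℝ) * (Kgreen (((i : ℕ) + 1 : ℝ) / (n + 1 : ℕ))
      ((j + 1 : ℕ) / (n + 1 : ℕ)) * u ((j + 1 : ℕ) / (n + 1 : ℕ))))]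
  refine Finset.sum_congr rfl fun j _ => ?_
  simp only [Kmat]
  push_cast
  ring

lemma tendsto_iSup_eigenvalues_Kmat {lam : ℝ} {u : ℝ → ℝ} (hu : IsClampedSolution lam u)
    (hne : ∃ x ∈ Icc (0:ℝ) 1, u x ≠ 0) (hnn : ∀ x ∈ Icc (0:ℝ) 1, 0 ≤ u x)
    (hsym : ∀ N : ℕ, (Kmat N).IsHermitian) :
    Tendsto (fun N : ℕ => ⨆ i, (hsym N).eigenvalues i) atTop (nhds lam⁻¹) := by
  obtain ⟨c, hc, hcu⟩ := hu.exists_le_of_nonneg hne hnn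
  obtain ⟨C, hC, hCN⟩ := hu.exists_abs_riemannSum_sub_le (hu.eigenvalue_pos hne).ne'
  have hlim : Tendsto (fun N : ℕ => C / c / (N : ℝ)) atTop (nhds 0) :=
    tendsto_const_div_atTop_nhds_zero_nat _
  rw [tendsto_iff_dist_tendsto_zero]
  refine squeeze_zero' (Eventually.of_forall fun _ => dist_nonneg) ?_ hlim
  filter_upwards [eventually_ge_atTop 2] with N hN
  obtain ⟨n, rfl⟩ : ∃ n, N = n + 1 := ⟨N - 1, by omega⟩
  have : Nonempty (Fin (n + 1 - 1)) := ⟨⟨0, by omega⟩⟩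
  have hn : (0:ℝ) < (n + 1 : ℕ) := by positivity
  have hmem (i : Fin (n + 1 - 1)) :
      ((i : ℕ) + 1 : ℝ) / (n + 1 : ℕ) ∈ Ioo (0:ℝ) 1 := by
    refine ⟨by positivity, (div_lt_one hn).2 ?_⟩
    have := i.2
    exact_mod_cast (by omega : (i : ℕ) + 1 < n + 1)
  rw [Real.dist_eq]
  refine (hsym (n + 1)).abs_iSup_eigenvalues_sub_le (fun i j => ?_)
    (u := fun j => u (((j : ℕ) + 1 : ℝ) / (n + 1 : ℕ))) (fun i => ?_) (fun i => ?_)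
  · exact mul_nonneg (by positivity) (Kgreen_nonneg (Ioo_subset_Icc_self (hmem i))
      (Ioo_subset_Icc_self (hmem j)))
  · have h1 := (hmem i).1
    have h2 : 0 < 1 - ((i : ℕ) + 1 : ℝ) / (n + 1 : ℕ) := sub_pos.2 (hmem i).2
    exact lt_of_lt_of_le (by positivity) (hcu _ (Ioo_subset_Icc_self (hmem i)))
  · have hx := Ioo_subset_Icc_self (hmem i)
    rw [Kmat_mulVec hu.zero]
    refine (hCN (n + 1) n.succ_pos _ hx).trans ?_
    calc _ = C / c / (n + 1 : ℕ) * (c * ((((i : ℕ) + 1 : ℝ) / (n + 1 : ℕ)) ^ 2 *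
          (1 - ((i : ℕ) + 1 : ℝ) / (n + 1 : ℕ)) ^ 2)) := by field_simp
      _ ≤ _ := mul_le_mul_of_nonneg_left (hcu _ hx) (by positivity)

/-- Convergence of the first discrete eigenvalue: the largest eigenvalue `μ_{h,1}` of
`K^h` converges to `λ₁⁻¹` as `N → ∞`; equivalently, the smallest discrete biharmonic
eigenvalue `λ_{h,1} = 1/μ_{h,1}` converges to `λ₁`. -/
theorem first_discrete_eigenvalue_convergence
    (lam1 : ℝ) (h1 : IsClampedBiharmonicEV lam1)
    (hmin : ∀ μ : ℝ, IsClampedBiharmonicEV μ → lam1 ≤ μ)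
    (hsym : ∀ N : ℕ, (Kmat N).IsHermitian) :
    Filter.Tendsto (fun N : ℕ => ⨆ i, (hsym N).eigenvalues i)
      Filter.atTop (nhds lam1⁻¹) ∧
    Filter.Tendsto (fun N : ℕ => (⨆ i, (hsym N).eigenvalues i)⁻¹)
      Filter.atTop (nhds lam1) := by
  obtain ⟨φ, hφ, hφne, hφeq, ha, ha', hb, hb'⟩ := h1
  have hφs : IsClampedSolution lam1 φ := ⟨hφ, hφeq, ha, ha', hb, hb'⟩
  obtain ⟨lam, u, hu, hune, hnn⟩ := exists_nonneg_isClampedSolution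
  have hlam1 := hφs.eigenvalue_pos hφne
  have hle : lam1 ≤ lam :=
    hmin lam ⟨u, hu.contDiff, hune, hu.eq, hu.zero, hu.deriv_zero, hu.one, hu.deriv_one⟩
  have hge : lam ≤ lam1 := by
    have := hu.le_abs_of_nonneg hune hnn hφs hφne
    rwa [abs_of_pos hlam1] at this
  obtain rfl := le_antisymm hle hge
  have hlim := tendsto_iSup_eigenvalues_Kmat hu hune hnn hsym
  refine ⟨hlim, ?_⟩
  simpa using hlim.inv₀ (inv_ne_zero hlam1.ne')
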